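/- arXiv:2510.19141 — 2 statements merged into one kernel-verified Lean document; each statement's English description precedes it below -/
import Mathlib

section
/- For all natural numbers i, j and every real r with 0 < r < 1, the series T_{ij}(r) := ∑_{t=0}^∞ C(t,i) C(t,j) r^{2t} converges and satisfies T_{ij}(r) = (1/(i! j!)) · ∑_{k=0}^{min(i,j)} C(i,k) C(j,k) k! (i+j−k)! · r^{2(i+j−k)} / (1−r²)^{i+j−k+1}. -/
theorem hasSum_choose_mul_pow {x : ℝ} (hx : |x| < 1) (m : ℕ) :
    HasSum (fun t : ℕ => (t.choose m : ℝ) * x ^ t) (x ^ m / (1 - x) ^ (m + 1)) := by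
  rw [← hasSum_nat_add_iff' m, Finset.sum_eq_zero, sub_zero]
  · convert! (hasSum_choose_mul_geometric_of_norm_lt_one m hx).mul_left (x ^ m) using 1
    · ext n
      ring
    · ring
  · intro t ht
    simp [Nat.choose_eq_zero_of_lt (Finset.mem_range.mp ht)]

theorem descFactorial_mul_descFactorial_eq_sum (t i j : ℕ) :
    t.descFactorial i * t.descFactorial j =
      ∑ k ∈ Finset.range (min i j + 1),
        i.choose k * j.choose k * k.factorial * t.descFactorial (i + j - k) := by
  rcases lt_or_ge t i with hti | hit
  · rw [Nat.descFactorial_of_lt hti, zero_mul, Finset.sum_eq_zero]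
    intro k hk
    rw [Finset.mem_range] at hk
    rw [Nat.descFactorial_of_lt (by omega), mul_zero]
  have vandermonde : t.choose j =
      ∑ k ∈ Finset.range (min i j + 1), i.choose k * (t - i).choose (j - k) := by
    conv_lhs => rw [← Nat.add_sub_cancel' hit]
    rw [Nat.add_choose_eq, Finset.Nat.sum_antidiagonal_eq_sum_range_succ_mk]
    symm
    apply Finset.sum_subset
    · exact Finset.range_subset_range.mpr (by omega)
    · intro k hk hk'
      rw [Finset.mem_range] at hk hk'
      rw [Nat.choose_eq_zero_of_lt (by omega), zero_mul]
  rw [Nat.descFactorial_eq_factorial_mul_choose t j, vandermonde, Finset.mul_sum, Finset.mul_sum]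
  refine Finset.sum_congr rfl fun k hk => ?_
  rw [Finset.mem_range] at hk
  have hkj : k ≤ j := by omega
  rw [← Nat.descFactorial_mul_descFactorial (show i ≤ i + j - k by omega),
    show i + j - k - i = j - k by omega, Nat.descFactorial_eq_factorial_mul_choose (t - i),
    ← Nat.choose_mul_factorial_mul_factorial hkj]
  ring


/-- For `0 < r < 1` the series `T_{ij}(r) = ∑_{t=0}^∞ C(t,i) C(t,j) r^{2t}`
converges, with sum
`(1/(i! j!)) ∑_{k=0}^{min(i,j)} C(i,k) C(j,k) k! (i+j-k)! r^{2(i+j-k)} / (1-r²)^{i+j-k+1}`. -/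
theorem hasSum_choose_mul_choose_pow (i j : ℕ) (r : ℝ) (hr0 : 0 < r) (hr1 : r < 1) :
    HasSum (fun t : ℕ => (t.choose i : ℝ) * (t.choose j : ℝ) * r ^ (2 * t))
      ((1 / ((i.factorial : ℝ) * (j.factorial : ℝ))) *
        ∑ k ∈ Finset.range (min i j + 1),
          (i.choose k : ℝ) * (j.choose k : ℝ) * (k.factorial : ℝ) *
            ((i + j - k).factorial : ℝ) *
            (r ^ (2 * (i + j - k)) / (1 - r ^ 2) ^ (i + j - k + 1))) := by
  have hx : |r ^ 2| < 1 := by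
    rw [abs_of_nonneg (sq_nonneg r)]
    exact pow_lt_one₀ hr0.le hr1 two_ne_zero
  convert! (hasSum_sum fun k (_ : k ∈ Finset.range (min i j + 1)) =>
    (hasSum_choose_mul_pow hx (i + j - k)).mul_left
      ((i.choose k : ℝ) * (j.choose k : ℝ) * (k.factorial : ℝ) *
        ((i + j - k).factorial : ℝ))).mul_left
      (1 / ((i.factorial : ℝ) * (j.factorial : ℝ))) using 1
  · ext t
    have h := congrArg (Nat.cast (R := ℝ)) (descFactorial_mul_descFactorial_eq_sum t i j)
    simp only [Nat.descFactorial_eq_factorial_mul_choose] at h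
    push_cast at h
    have hi : (i.factorial : ℝ) ≠ 0 := by positivity
    have hj : (j.factorial : ℝ) ≠ 0 := by positivity
    simp only [← mul_assoc] at h ⊢
    rw [← Finset.sum_mul, ← h, pow_mul]
    field_simp
  · simp only [pow_mul]
end

section
/- Let m ≥ 1 and let r ∈ (0,1). Define W(r) ∈ ℝ^{m×m}, indexed by i, t ∈ {0,…,m−1}, by W(r)_{it} = C(t,i)·r^{t−i} if i ≤ t and W(r)_{it} = 0 if i > t. Then det W(r) = 1, and the matrix S(r) − W(r)·W(r)ᵀ is positive semidefinite; consequently S(r) ⪰ W(r)W(r)ᵀ ≻ 0. -/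
open Matrix

/-- The matrix `S(r)` with entries
`S(r)_{ij} = r^{-(i+j)} ∑_{t=0}^∞ C(t,i) C(t,j) r^{2t}`. -/
noncomputable def Smat (m : ℕ) (r : ℝ) : Matrix (Fin m) (Fin m) ℝ :=
  fun i j =>
    (∑' t : ℕ, ((t.choose (i : ℕ) : ℝ) * (t.choose (j : ℕ) : ℝ)) * r ^ (2 * t)) /
      r ^ ((i : ℕ) + (j : ℕ))

/-- The upper-triangular matrix `W(r)` with `W(r)_{it} = C(t,i) r^{t-i}` for
`i ≤ t` and `0` otherwise. -/
noncomputable def Wmat (m : ℕ) (r : ℝ) : Matrix (Fin m) (Fin m) ℝ :=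
  fun i t =>
    if (i : ℕ) ≤ (t : ℕ) then ((t : ℕ).choose (i : ℕ) : ℝ) * r ^ ((t : ℕ) - (i : ℕ))
    else 0

/-- A real matrix whose entries are the inner products of the rows of a square-summable infinite
family is positive semidefinite. -/
theorem Matrix.PosSemidef.of_hasSum_mul {n ι : Type*} [Fintype n] {M : Matrix n n ℝ}
    {f : ι → n → ℝ} (h : ∀ i j, HasSum (fun t => f t i * f t j) (M i j)) : M.PosSemidef := by
  refine .of_dotProduct_mulVec_nonneg ?_ fun x => ?_
  · ext i j
    simpa [mul_comm] using (h j i).unique (by simpa only [mul_comm] using h i j)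
  · have hx : HasSum (fun t => (∑ i, x i * f t i) ^ 2) (star x ⬝ᵥ (M *ᵥ x)) := by
      have := hasSum_sum fun i (_ : i ∈ Finset.univ) =>
        (hasSum_sum fun j (_ : j ∈ Finset.univ) => (h i j).mul_right (x j)).mul_left (x i)
      change HasSum _ (∑ i, x i * ∑ j, M i j * x j)
      convert! this using 2 with t
      rw [sq, Finset.sum_mul_sum]
      refine Finset.sum_congr rfl fun i _ => ?_
      rw [Finset.mul_sum]
      exact Finset.sum_congr rfl fun j _ => by ring
    exact hx.nonneg fun t => sq_nonneg _

theorem summable_choose_mul_choose_mul_pow (i j : ℕ) {r : ℝ} (hr0 : 0 < r) (hr1 : r < 1) :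
    Summable fun t : ℕ => ((t.choose i : ℝ) * (t.choose j : ℝ)) * r ^ (2 * t) := by
  have hr : ‖r ^ 2‖ < 1 := by
    rw [Real.norm_of_nonneg (by positivity)]
    exact pow_lt_one₀ hr0.le hr1 two_ne_zero
  refine (summable_pow_mul_geometric_of_norm_lt_one (i + j) hr).of_nonneg_of_le
    (fun t => by positivity) fun t => ?_
  rw [pow_mul, pow_add]
  gcongr <;> exact_mod_cast Nat.choose_le_pow t _

theorem Smat_hasSum {m : ℕ} {r : ℝ} (hr0 : 0 < r) (hr1 : r < 1) (i j : Fin m) :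
    HasSum (fun t : ℕ => ((t.choose i : ℝ) * r ^ t / r ^ (i : ℕ)) *
      ((t.choose j : ℝ) * r ^ t / r ^ (j : ℕ))) (Smat m r i j) := by
  convert! (summable_choose_mul_choose_mul_pow i j hr0 hr1).hasSum.div_const
    (r ^ ((i : ℕ) + (j : ℕ))) using 2 with t
  rw [div_mul_div_comm, ← pow_add, two_mul, pow_add]
  ring

theorem Wmat_apply {m : ℕ} {r : ℝ} (hr : r ≠ 0) (i t : Fin m) :
    Wmat m r i t = ((t : ℕ).choose i : ℝ) * r ^ (t : ℕ) / r ^ (i : ℕ) := by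
  unfold Wmat
  split_ifs with h
  · rw [pow_sub₀ r hr h, ← div_eq_mul_inv, mul_div_assoc]
  · simp [Nat.choose_eq_zero_of_lt (not_le.mp h)]

theorem Wmat_det (m : ℕ) (r : ℝ) : (Wmat m r).det = 1 := by
  have h : (Wmat m r).BlockTriangular id := fun i j hij => if_neg (not_le.mpr hij)
  simp [det_of_isUpperTriangular h, Wmat]

theorem Smat_sub_Wmat_mul_transpose_posSemidef (m : ℕ) {r : ℝ} (hr0 : 0 < r) (hr1 : r < 1) :
    (Smat m r - Wmat m r * (Wmat m r).transpose).PosSemidef := by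
  refine .of_hasSum_mul (f := fun (t : ℕ) (i : Fin m) =>
    ((t + m).choose i : ℝ) * r ^ (t + m) / r ^ (i : ℕ)) fun i j => ?_
  convert! (hasSum_nat_add_iff' m).mpr (Smat_hasSum hr0 hr1 i j) using 1
  simp only [Matrix.sub_apply, mul_apply, transpose_apply, Wmat_apply hr0.ne']
  rw [Fin.sum_univ_eq_sum_range (fun t : ℕ => ((t.choose i : ℝ) * r ^ t / r ^ (i : ℕ)) *
      ((t.choose j : ℝ) * r ^ t / r ^ (j : ℕ)))]

theorem Wmat_mul_transpose_posDef (m : ℕ) (r : ℝ) :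
    (Wmat m r * (Wmat m r).transpose).PosDef := by
  rw [← conjTranspose_eq_transpose_of_trivial]
  refine .mul_conjTranspose_self _ (vecMul_injective_iff_isUnit.mpr ?_)
  simp [isUnit_iff_isUnit_det, Wmat_det]

/-- `det W(r) = 1`, `S(r) - W(r)W(r)ᵀ` is positive semidefinite, and
consequently `S(r) ⪰ W(r)W(r)ᵀ ≻ 0`. -/
theorem Smat_ge_Wmat_mul_transpose (m : ℕ) (hm : 1 ≤ m) (r : ℝ)
    (hr0 : 0 < r) (hr1 : r < 1) :
    (Wmat m r).det = 1 ∧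
      (Smat m r - Wmat m r * (Wmat m r).transpose).PosSemidef ∧
      (Wmat m r * (Wmat m r).transpose).PosDef ∧
      (Smat m r).PosDef := by
  have hS := Smat_sub_Wmat_mul_transpose_posSemidef m hr0 hr1
  have hW := Wmat_mul_transpose_posDef m r
  exact ⟨Wmat_det m r, hS, hW, by simpa using PosDef.posSemidef_add hS hW⟩
end
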